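/- Assume det A ≠ 0, tr A = 0, η = 0, α = 0 (so Σ_ℍ reads v̇ = Av + uζ, ż = (u/2)ω(v,ζ)), and ω(Aζ, ζ) ≠ 0. Then: (1) if ω(Aζ,ζ)/det A > 0, for any z₁ < z₂ there exist T > 0 and an admissible control u with φ(T,(0,z₁),u) = (0,z₂); (2) if ω(Aζ,ζ)/det A < 0, for any z₁ < z₂ there exist T > 0 and an admissible control u with φ(T,(0,z₂),u) = (0,z₁). -/

import Mathlib

open Set Matrix

noncomputable section

/-- Vectors in the plane. -/
abbrev V2 := Fin 2 → ℝ

/-- The standard symplectic form on `ℝ²`: `ω(v,w) = v₁w₂ − v₂w₁`. -/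
def omega2 (v w : V2) : ℝ := v 0 * w 1 - v 1 * w 0

/-- Counterclockwise rotation by `π/2`. -/
def theta (v : V2) : V2 := ![-(v 1), v 0]

/-- `u` is piecewise constant on `[0,∞)`: on every interval `[0,T]` it is a finite
step function (right-continuous convention). -/
def PiecewiseConst (u : ℝ → ℝ) : Prop :=
  ∀ T : ℝ, 0 ≤ T → ∃ (n : ℕ) (τ : ℕ → ℝ), τ 0 = 0 ∧ StrictMono τ ∧ T ≤ τ n ∧
    ∀ i < n, ∀ s ∈ Ico (τ i) (τ (i + 1)), u s = u (τ i)

/-- Admissible controls: piecewise constant functions with values in `Ω`. -/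
def Admissible (Ω : Set ℝ) (u : ℝ → ℝ) : Prop :=
  (∀ t, u t ∈ Ω) ∧ PiecewiseConst u

/-- `x` is a trajectory of the control system `ẋ = f(u(t), x)` on `[0,∞)`
with control `u`. -/
def IsTraj {M : Type*} [NormedAddCommGroup M] [NormedSpace ℝ M]
    (f : ℝ → M → M) (u : ℝ → ℝ) (x : ℝ → M) : Prop :=
  ContinuousOn x (Ici 0) ∧
    ∀ t ∈ Ici (0 : ℝ), HasDerivWithinAt x (f (u t) (x t)) (Ici t) t

/-- The positive orbit `O⁺(p)` of the control system `f` with control range `Ω`. -/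
def PosOrbit {M : Type*} [NormedAddCommGroup M] [NormedSpace ℝ M]
    (f : ℝ → M → M) (Ω : Set ℝ) (p : M) : Set M :=
  {q | ∃ (u : ℝ → ℝ) (x : ℝ → M) (T : ℝ), Admissible Ω u ∧ IsTraj f u x ∧
    x 0 = p ∧ 0 ≤ T ∧ x T = q}

/-- The two defining properties of a control set: (i) for every `p ∈ C` there is an
admissible control keeping the trajectory in `C` for all positive times;
(ii) `C ⊆ cl O⁺(p)` for all `p ∈ C`.  (Nonemptiness is also required.) -/
def ControlSetProp {M : Type*} [NormedAddCommGroup M] [NormedSpace ℝ M]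
    (f : ℝ → M → M) (Ω : Set ℝ) (C : Set M) : Prop :=
  C.Nonempty ∧
  (∀ p ∈ C, ∃ (u : ℝ → ℝ) (x : ℝ → M), Admissible Ω u ∧ IsTraj f u x ∧ x 0 = p ∧
      ∀ t : ℝ, 0 ≤ t → x t ∈ C) ∧
  (∀ p ∈ C, C ⊆ closure (PosOrbit f Ω p))

/-- A control set: a set satisfying `ControlSetProp`, maximal w.r.t. set inclusion
among such sets. -/
def IsControlSet {M : Type*} [NormedAddCommGroup M] [NormedSpace ℝ M]
    (f : ℝ → M → M) (Ω : Set ℝ) (C : Set M) : Prop :=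
  ControlSetProp f Ω C ∧ ∀ C', ControlSetProp f Ω C' → C ⊆ C' → C = C'

/-- The right-hand side of the linear control system `Σ_ℍ` on the Heisenberg group
`ℍ = ℝ² × ℝ`:  `v̇ = Av + uζ`, `ż = (tr A) z + uα + ω(v, θη + (u/2)ζ)`. -/
def heisF (A : Matrix (Fin 2) (Fin 2) ℝ) (η ζ : V2) (α : ℝ) (u : ℝ)
    (p : V2 × ℝ) : V2 × ℝ :=
  (A.mulVec p.1 + u • ζ,
    A.trace * p.2 + u * α + omega2 p.1 (theta η + (u / 2) • ζ))

/-- The right-hand side of the planar linear control system `v̇ = Av + uζ`. -/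
def planF (A : Matrix (Fin 2) (Fin 2) ℝ) (ζ : V2) (u : ℝ) (v : V2) : V2 :=
  A.mulVec v + u • ζ

/-- The derivation `𝒟(v,z) = (Av, ω(v,θη) + (tr A) z)` of the Heisenberg Lie
algebra associated to the drift of `Σ_ℍ`. -/
def Dmap (A : Matrix (Fin 2) (Fin 2) ℝ) (η : V2) (p : V2 × ℝ) : V2 × ℝ :=
  (A.mulVec p.1, omega2 p.1 (theta η) + A.trace * p.2)

lemma omega2_add_smul_mulVec (A : Matrix (Fin 2) (Fin 2) ℝ) (ζ : V2) (x y u : ℝ) :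
    omega2 (x • ζ + y • A.mulVec ζ) (u • ζ) = u * y * omega2 (A.mulVec ζ) ζ := by
  simp only [omega2, Pi.add_apply, Pi.smul_apply, smul_eq_mul]
  ring

lemma mulVec_mulVec_of_trace_eq_zero {A : Matrix (Fin 2) (Fin 2) ℝ} (htr : A.trace = 0)
    (ζ : V2) : A.mulVec (A.mulVec ζ) = (-A.det) • ζ := by
  rw [Matrix.trace_fin_two] at htr
  have h : A 1 1 = -A 0 0 := by linarith
  ext i
  fin_cases i <;>
    simp [Matrix.mulVec, dotProduct, Fin.sum_univ_two, Matrix.det_fin_two, h] <;> ring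

/-- In the coordinates `v = x ζ + y A ζ` and for a constant control `u`, the system reads
`ẋ = u - (det A) y`, `ẏ = x`, `ż = (u / 2) ω(Aζ, ζ) y`. -/
lemma isTraj_const {A : Matrix (Fin 2) (Fin 2) ℝ} {ζ : V2} (htr : A.trace = 0) {u : ℝ}
    {x y z : ℝ → ℝ} (hx : ∀ t, HasDerivAt x (u - A.det * y t) t)
    (hy : ∀ t, HasDerivAt y (x t) t)
    (hz : ∀ t, HasDerivAt z (u / 2 * omega2 (A.mulVec ζ) ζ * y t) t) :
    IsTraj (heisF A 0 ζ 0) (fun _ => u) (fun t => (x t • ζ + y t • A.mulVec ζ, z t)) := by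
  have key : ∀ t, HasDerivAt (fun t => (x t • ζ + y t • A.mulVec ζ, z t))
      (heisF A 0 ζ 0 u (x t • ζ + y t • A.mulVec ζ, z t)) t := by
    intro t
    refine ((((hx t).smul_const ζ).add ((hy t).smul_const (A.mulVec ζ))).prodMk
      (hz t)).congr_deriv ?_
    have hθ : theta 0 = 0 := by ext i; fin_cases i <;> simp [theta]
    simp only [heisF, hθ, zero_add, omega2_add_smul_mulVec, htr, Matrix.mulVec_add,
      Matrix.mulVec_smul, mulVec_mulVec_of_trace_eq_zero htr]
    refine Prod.ext ?_ ?_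
    · simp only
      module
    · simp only
      ring
  exact ⟨fun t _ => (key t).continuousAt.continuousWithinAt,
    fun t _ => (key t).hasDerivWithinAt⟩

lemma IsTraj.glue {M : Type*} [NormedAddCommGroup M] [NormedSpace ℝ M] {f : ℝ → M → M}
    {u u' : ℝ → ℝ} {x x' : ℝ → M} {s : ℝ} (hs : 0 ≤ s) (h : IsTraj f u x)
    (h' : IsTraj f u' x') (hxx' : x s = x' s) :
    IsTraj f (fun t => if t < s then u t else u' t) (fun t => if t < s then x t else x' t) := by
  have hle : ∀ t ≤ s, (if t < s then x t else x' t) = x t := by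
    intro t ht
    rcases ht.lt_or_eq with h | rfl
    · rw [if_pos h]
    · simp [hxx']
  have hge : ∀ t, s ≤ t → (if t < s then x t else x' t) = x' t :=
    fun t ht => if_neg ht.not_gt
  refine ⟨?_, fun t ht => ?_⟩
  · rw [← Icc_union_Ici_eq_Ici hs]
    refine ContinuousOn.union_of_isClosed ?_ ?_ isClosed_Icc isClosed_Ici
    · exact (h.1.mono Icc_subset_Ici_self).congr fun t ht => hle t ht.2
    · exact (h'.1.mono (Ici_subset_Ici.2 hs)).congr fun t ht => hge t ht
  · by_cases hts : t < s
    · simp only [if_pos hts]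
      refine (h.2 t ht).congr_of_eventuallyEq ?_ (hle t hts.le)
      filter_upwards [mem_nhdsWithin_of_mem_nhds (Iio_mem_nhds hts)] with r hr
      exact hle r (le_of_lt hr)
    · simp only [if_neg hts]
      exact (h'.2 t ht).congr (fun r hr => hge r ((not_lt.1 hts).trans hr)) (hge t (not_lt.1 hts))

lemma piecewiseConst_const (c : ℝ) : PiecewiseConst fun _ => c := by
  intro T hT
  refine ⟨1, fun i => i * (T + 1), by simp, ?_, by simp, fun _ _ _ _ => rfl⟩
  exact strictMono_nat_of_lt_succ fun n => by push_cast; nlinarith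

lemma piecewiseConst_three_steps {a b : ℝ} (ha : 0 < a) (hab : a < b) (p q r : ℝ) :
    PiecewiseConst fun t => if t < a then p else if t < b then q else r := by
  intro T hT
  refine ⟨3, fun i => if i = 0 then 0 else if i = 1 then a else b + (i - 2) * (T + 1),
    by simp, strictMono_nat_of_lt_succ fun n => ?_, ?_, fun i hi s hs => ?_⟩
  · match n with
    | 0 => simpa using ha
    | 1 => norm_num; exact hab
    | n + 2 =>
      simp
      nlinarith
  · norm_num
    linarith
  · interval_cases i
    · simp at hs
      simp [hs.2, ha]
    · norm_num at hs
      simp [hs.1.not_gt, hs.2, hab]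
    · norm_num at hs
      have : a ≤ s := hab.le.trans hs.1
      simp [this.not_gt, hs.1.not_gt, hab.le.not_gt]

/-- An elliptic drift: a constant control run over finitely many periods. -/
lemma exists_traj_of_det_pos {A : Matrix (Fin 2) (Fin 2) ℝ} {ζ : V2} {u₁ u₂ : ℝ}
    (h₁ : u₁ < 0) (h₂ : 0 < u₂) (hdet : 0 < A.det) (htr : A.trace = 0) {K : ℝ} (hK : 0 < K)
    (z₀ : ℝ) :
    ∃ (T : ℝ) (u : ℝ → ℝ) (x : ℝ → V2 × ℝ), 0 < T ∧ Admissible (Icc u₁ u₂) u ∧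
      IsTraj (heisF A 0 ζ 0) u x ∧ x 0 = (0, z₀) ∧
      x T = (0, z₀ + omega2 (A.mulVec ζ) ζ * K / 2) := by
  obtain ⟨k, hk, hkd⟩ : ∃ k : ℝ, 0 < k ∧ A.det = k ^ 2 :=
    ⟨√A.det, Real.sqrt_pos.2 hdet, (Real.sq_sqrt hdet.le).symm⟩
  obtain ⟨n, hn⟩ := exists_nat_gt (K * k ^ 3 / (2 * Real.pi * u₂ ^ 2))
  have hπ := Real.pi_pos
  have hn0 : (0 : ℝ) < n := lt_of_le_of_lt (by positivity) hn
  rw [div_lt_iff₀ (by positivity)] at hn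
  set u := √(K * k ^ 3 / (2 * Real.pi * n)) with hu
  have husq : u ^ 2 = K * k ^ 3 / (2 * Real.pi * n) := Real.sq_sqrt (by positivity)
  have hu0 : 0 ≤ u := Real.sqrt_nonneg _
  have huu : u ≤ u₂ := by
    refine abs_le_of_sq_le_sq' ?_ h₂.le |>.2
    rw [husq, div_le_iff₀ (by positivity)]
    linarith
  have hlin : ∀ t : ℝ, HasDerivAt (fun t => k * t) k t := fun t => by
    simpa using (hasDerivAt_id t).const_mul k
  have hsin : ∀ t : ℝ, HasDerivAt (fun t => Real.sin (k * t)) (Real.cos (k * t) * k) t :=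
    fun t => (hlin t).sin
  have hcos : ∀ t : ℝ, HasDerivAt (fun t => Real.cos (k * t)) (-Real.sin (k * t) * k) t :=
    fun t => (hlin t).cos
  refine ⟨n * (2 * Real.pi) / k, fun _ => u, _, by positivity,
    ⟨fun _ => ⟨by linarith, huu⟩, piecewiseConst_const u⟩,
    isTraj_const (x := fun t => u / k * Real.sin (k * t))
      (y := fun t => u / k ^ 2 * (1 - Real.cos (k * t)))
      (z := fun t => z₀ + omega2 (A.mulVec ζ) ζ / 2 * (u ^ 2 / k ^ 2) *
        (t - Real.sin (k * t) / k)) htr ?_ ?_ ?_, ?_, ?_⟩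
  · intro t
    refine ((hsin t).const_mul (u / k)).congr_deriv ?_
    rw [hkd]
    field_simp
    ring
  · intro t
    refine (((hcos t).const_sub 1).const_mul (u / k ^ 2)).congr_deriv ?_
    field_simp
  · intro t
    refine ((((hasDerivAt_id t).sub ((hsin t).div_const k)).const_mul
      (omega2 (A.mulVec ζ) ζ / 2 * (u ^ 2 / k ^ 2))).const_add z₀).congr_deriv ?_
    field_simp
  · simp
  · have hT : k * (n * (2 * Real.pi) / k) = n * (2 * Real.pi) := by field_simp
    have hs : Real.sin (n * (2 * Real.pi)) = 0 := by
      simpa using Real.sin_add_nat_mul_two_pi 0 n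
    simp only [hT, hs, Real.cos_nat_mul_two_pi, husq]
    simp
    field_simp

/-- A trajectory with constant control when `det A = - k²`. -/
lemma isTraj_hyperbolic {A : Matrix (Fin 2) (Fin 2) ℝ} (ζ : V2) {k : ℝ} (hk : k ≠ 0)
    (hkd : A.det = -k ^ 2) (htr : A.trace = 0) (u e t₀ z₀ : ℝ) :
    IsTraj (heisF A 0 ζ 0) (fun _ => u) (fun t =>
      ((e * Real.sinh (k * (t - t₀)) / k) • ζ +
        ((e * Real.cosh (k * (t - t₀)) - u) / k ^ 2) • A.mulVec ζ,
      z₀ + u / 2 * omega2 (A.mulVec ζ) ζ *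
        ((e * Real.sinh (k * (t - t₀)) / k - u * (t - t₀)) / k ^ 2))) := by
  have hlin : ∀ t : ℝ, HasDerivAt (fun t => k * (t - t₀)) k t := fun t => by
    simpa using ((hasDerivAt_id t).sub_const t₀).const_mul k
  have hsinh : ∀ t : ℝ, HasDerivAt (fun t => e * Real.sinh (k * (t - t₀)) / k)
      (e * (Real.cosh (k * (t - t₀)) * k) / k) t :=
    fun t => ((hlin t).sinh.const_mul e).div_const k
  refine isTraj_const htr (fun t => ?_) (fun t => ?_) (fun t => ?_)
  · refine (hsinh t).congr_deriv ?_
    rw [hkd]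
    field_simp
    ring
  · refine ((((hlin t).cosh.const_mul e).sub_const u).div_const (k ^ 2)).congr_deriv ?_
    field_simp
  · refine (((((hsinh t).sub (((hasDerivAt_id t).sub_const t₀).const_mul u)).div_const
      (k ^ 2)).const_mul (u / 2 * omega2 (A.mulVec ζ) ζ)).const_add z₀).congr_deriv ?_
    field_simp

/-- The amplitude `β` and half-duration `p` of the loop used for a hyperbolic drift. -/
lemma exists_loop_parameters {K k m : ℝ} (hK : 0 < K) (hk : 0 < k) (hm : 0 < m) :
    ∃ p β H : ℝ, 0 < p ∧ 0 ≤ β ∧ 0 ≤ β * (2 * Real.cosh p - 1) ∧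
      (β ≤ m ∧ β * (2 * Real.cosh p - 1) ≤ m) ∧
      H = ((2 * Real.cosh p - 1) ^ 2 + 1) * p - 2 * Real.cosh p * Real.sinh p ∧
      K = 2 * β ^ 2 * H / k ^ 3 := by
  obtain ⟨p, hp0, hp⟩ : ∃ p : ℝ, 0 < p ∧ p = K * k ^ 3 / m ^ 2 + 3 :=
    ⟨_, by positivity, rfl⟩
  obtain ⟨C, hC⟩ : ∃ C, C = Real.cosh p := ⟨_, rfl⟩
  obtain ⟨S, hS⟩ : ∃ S, S = Real.sinh p := ⟨_, rfl⟩
  have hC1 : 1 ≤ C := hC ▸ Real.one_le_cosh p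
  have hSC : S ≤ C := by rw [hC, hS]; exact (Real.sinh_lt_cosh p).le
  obtain ⟨w, hw⟩ : ∃ w, w = 2 * C - 1 := ⟨_, rfl⟩
  have hw1 : 1 ≤ w := by linarith
  obtain ⟨H, hH⟩ : ∃ H, H = (w ^ 2 + 1) * p - 2 * C * S := ⟨_, rfl⟩
  have hHle : w ^ 2 * (K * k ^ 3 / m ^ 2 + 1) ≤ H := by
    have h1 : C * S ≤ C * C := by gcongr
    have h2 : C * C ≤ w * w := by gcongr <;> linarith
    have h3 : w ^ 2 * (K * k ^ 3 / m ^ 2 + 1) = w ^ 2 * p - 2 * w ^ 2 := by rw [hp]; ring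
    rw [h3, hH]
    nlinarith
  have hH0 : 0 < H := lt_of_lt_of_le (by positivity) hHle
  obtain ⟨β, hβ0, hβ⟩ : ∃ β : ℝ, 0 ≤ β ∧ β ^ 2 = K * k ^ 3 / (2 * H) :=
    ⟨√(K * k ^ 3 / (2 * H)), Real.sqrt_nonneg _, Real.sq_sqrt (by positivity)⟩
  have hβw : β * w ≤ m := by
    refine abs_le_of_sq_le_sq' ?_ hm.le |>.2
    rw [mul_pow, hβ, div_mul_eq_mul_div, div_le_iff₀ (by positivity)]
    have h4 : m ^ 2 * (w ^ 2 * (K * k ^ 3 / m ^ 2 + 1)) = w ^ 2 * (K * k ^ 3 + m ^ 2) := by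
      field_simp
    have h5 := mul_le_mul_of_nonneg_left hHle (sq_nonneg m)
    rw [h4] at h5
    nlinarith [mul_pos hm hm, mul_pos (mul_pos hm hm) hH0, sq_nonneg (w * m)]
  have hββ : β ≤ m := le_trans (by nlinarith) hβw
  subst hw hC hS
  exact ⟨p, β, H, hp0, hβ0, mul_nonneg hβ0 (by linarith), ⟨hββ, hβw⟩, hH, by
    rw [hβ]; field_simp⟩

/-- A hyperbolic drift: a control switching twice, symmetric about the middle of `[0, 4a]`. -/
lemma exists_traj_of_det_neg {A : Matrix (Fin 2) (Fin 2) ℝ} {ζ : V2} {u₁ u₂ : ℝ}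
    (h₁ : u₁ < 0) (h₂ : 0 < u₂) (hdet : A.det < 0) (htr : A.trace = 0) {K : ℝ} (hK : 0 < K)
    (z₀ : ℝ) :
    ∃ (T : ℝ) (u : ℝ → ℝ) (x : ℝ → V2 × ℝ), 0 < T ∧ Admissible (Icc u₁ u₂) u ∧
      IsTraj (heisF A 0 ζ 0) u x ∧ x 0 = (0, z₀) ∧
      x T = (0, z₀ - omega2 (A.mulVec ζ) ζ * K / 2) := by
  obtain ⟨k, hk, hkd⟩ : ∃ k : ℝ, 0 < k ∧ A.det = -k ^ 2 :=
    ⟨√(-A.det), Real.sqrt_pos.2 (by linarith), by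
      rw [Real.sq_sqrt (by linarith : 0 ≤ -A.det)]; ring⟩
  obtain ⟨m, hm, hm₁, hm₂⟩ : ∃ m : ℝ, 0 < m ∧ u₁ ≤ -m ∧ m ≤ u₂ :=
    ⟨min (-u₁) u₂, lt_min (by linarith) h₂, by linarith [min_le_left (-u₁) u₂],
      min_le_right _ _⟩
  obtain ⟨p, β, H, hp0, hβ0, hβw, ⟨hβm, hβwm⟩, hH, hK'⟩ := exists_loop_parameters hK hk hm
  obtain ⟨C, hC⟩ : ∃ C, C = Real.cosh p := ⟨_, rfl⟩
  obtain ⟨S, hS⟩ : ∃ S, S = Real.sinh p := ⟨_, rfl⟩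
  obtain ⟨w, hw⟩ : ∃ w, w = 2 * C - 1 := ⟨_, rfl⟩
  rw [← hC, ← hw] at hβw hβwm
  rw [← hC, ← hS, ← hw] at hH
  have mem_β : β ∈ Icc u₁ u₂ := ⟨by linarith, by linarith⟩
  have mem_βw : -(β * w) ∈ Icc u₁ u₂ := ⟨by linarith, by linarith⟩
  obtain ⟨a, ha⟩ : ∃ a, a = p / k := ⟨_, rfl⟩
  have ha0 : 0 < a := ha ▸ by positivity
  have hka : k * a = p := by rw [ha]; field_simp
  obtain ⟨c, hc⟩ : ∃ c, c = omega2 (A.mulVec ζ) ζ := ⟨_, rfl⟩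
  have hseg := isTraj_hyperbolic ζ hk.ne' hkd htr
  rw [← hc] at hseg ⊢
  refine ⟨4 * a, _, _, by positivity, ⟨?_, ?_⟩,
    IsTraj.glue ha0.le (hseg β β 0 z₀)
      (IsTraj.glue (s := 3 * a) (by positivity)
        (hseg (-(β * w)) (-β) (2 * a) (z₀ - c * K / 4))
        (hseg β β (4 * a) (z₀ - c * K / 2)) ?_) ?_, ?_, ?_⟩
  · intro t
    split_ifs <;> assumption
  · exact piecewiseConst_three_steps ha0 (by linarith) _ _ _
  · have e₁ : k * (3 * a - 2 * a) = p := by rw [← hka]; ring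
    have e₂ : k * (3 * a - 4 * a) = -p := by rw [← hka]; ring
    simp only [e₁, e₂, Real.sinh_neg, Real.cosh_neg, ← hC, ← hS]
    refine Prod.ext ?_ ?_
    · dsimp only
      rw [hw]
      congr 2 <;> ring
    · simp only
      rw [hK', ha, hH, hw]
      field_simp
      ring
  · have e₁ : k * (a - 0) = p := by rw [← hka]; ring
    have e₂ : k * (a - 2 * a) = -p := by rw [← hka]; ring
    rw [if_pos (by linarith : a < 3 * a)]
    simp only [e₁, e₂, Real.sinh_neg, Real.cosh_neg, ← hC, ← hS]
    refine Prod.ext ?_ ?_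
    · dsimp only
      rw [hw]
      congr 2 <;> ring
    · simp only
      rw [hK', ha, hH, hw]
      field_simp
      ring
  · simp [ha0]
  · have e₁ : ¬ 4 * a < a := by linarith
    have e₂ : ¬ 4 * a < 3 * a := by linarith
    simp [e₁, e₂]

/-- assume `det A ≠ 0`, `tr A = 0`, `η = 0`, `α = 0`, and the LARC
`ω(Aζ,ζ) ≠ 0`. Then: (1) if `ω(Aζ,ζ)/det A > 0`, for any `z₁ < z₂` one can go
from `(0,z₁)` to `(0,z₂)` in positive time; (2) if `ω(Aζ,ζ)/det A < 0`, for any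
`z₁ < z₂` one can go from `(0,z₂)` to `(0,z₁)` in positive time. -/
theorem stmt10 (A : Matrix (Fin 2) (Fin 2) ℝ) (ζ : V2) (u₁ u₂ : ℝ)
    (h₁ : u₁ < 0) (h₂ : 0 < u₂)
    (hdet : A.det ≠ 0) (htr : A.trace = 0)
    (hLARC : omega2 (A.mulVec ζ) ζ ≠ 0) :
    (0 < omega2 (A.mulVec ζ) ζ / A.det →
      ∀ z₁ z₂ : ℝ, z₁ < z₂ → ∃ (T : ℝ) (u : ℝ → ℝ) (x : ℝ → V2 × ℝ), 0 < T ∧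
        Admissible (Icc u₁ u₂) u ∧ IsTraj (heisF A 0 ζ 0) u x ∧
        x 0 = (((0 : V2), z₁) : V2 × ℝ) ∧ x T = (((0 : V2), z₂) : V2 × ℝ)) ∧
    (omega2 (A.mulVec ζ) ζ / A.det < 0 →
      ∀ z₁ z₂ : ℝ, z₁ < z₂ → ∃ (T : ℝ) (u : ℝ → ℝ) (x : ℝ → V2 × ℝ), 0 < T ∧
        Admissible (Icc u₁ u₂) u ∧ IsTraj (heisF A 0 ζ 0) u x ∧
        x 0 = (((0 : V2), z₂) : V2 × ℝ) ∧ x T = (((0 : V2), z₁) : V2 × ℝ)) := by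
  have key : ∀ z₀ Δ : ℝ, 0 < Δ * (omega2 (A.mulVec ζ) ζ / A.det) →
      ∃ (T : ℝ) (u : ℝ → ℝ) (x : ℝ → V2 × ℝ), 0 < T ∧ Admissible (Icc u₁ u₂) u ∧
        IsTraj (heisF A 0 ζ 0) u x ∧ x 0 = (0, z₀) ∧ x T = (0, z₀ + Δ) := by
    intro z₀ Δ hΔ
    set c := omega2 (A.mulVec ζ) ζ with hc
    have hpos : 0 < Δ / c / A.det := by
      have h : Δ / c / A.det = Δ * (c / A.det) / c ^ 2 := by field_simp
      rw [h]
      positivity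
    rcases hdet.lt_or_gt with hd | hd
    · have hK : 0 < -(2 * (Δ / c)) := by
        have := (div_pos_iff.1 hpos).resolve_left fun h => hd.not_gt h.2
        linarith [this.1]
      obtain ⟨T, u, x, hT, hu, hx, hx0, hxT⟩ :=
        exists_traj_of_det_neg (ζ := ζ) h₁ h₂ hd htr hK z₀
      refine ⟨T, u, x, hT, hu, hx, hx0, hxT.trans ?_⟩
      rw [← hc]
      congr 1
      field_simp
      ring
    · have hK : 0 < 2 * (Δ / c) := by
        have := (div_pos_iff_of_pos_right hd).1 hpos
        linarith
      obtain ⟨T, u, x, hT, hu, hx, hx0, hxT⟩ :=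
        exists_traj_of_det_pos (ζ := ζ) h₁ h₂ hd htr hK z₀
      refine ⟨T, u, x, hT, hu, hx, hx0, hxT.trans ?_⟩
      rw [← hc]
      congr 1
      field_simp
  refine ⟨fun h z₁ z₂ hz => ?_, fun h z₁ z₂ hz => ?_⟩
  · simpa using key z₁ (z₂ - z₁) (mul_pos (sub_pos.2 hz) h)
  · simpa using key z₂ (z₁ - z₂) (mul_pos_of_neg_of_neg (sub_neg.2 hz) h)
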